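/- Upper half of the directional-derivative bound: let 𝒢 be a nonempty finite set, B a nonempty compact subset of ℝ^{𝒢×𝒢}, ⟨Γ, f⟩ := ∑_{u,v∈𝒢} Γ(u,v) f(v), φ(f) := max_{Γ∈B} ⟨Γ, f⟩, and S*(f) := {Γ ∈ B : ⟨Γ, f⟩ = φ(f)}. For every f, h : 𝒢 → ℝ, every family (h_t)_{t>0} with h_t → h as t ↓ 0, and every choice Γ_t ∈ S*(f + t h_t) and Γ_0 ∈ S*(f): limsup_{t↓0} (⟨Γ_t, f + t h_t⟩ − ⟨Γ_0, f⟩)/t ≤ max_{Γ ∈ S*(f)} ⟨Γ, h⟩. -/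

import Mathlib

open Filter Topology

/-- The pairing `⟨Γ, f⟩ = ∑_{u,v} Γ(u,v) f(v)`. -/
noncomputable def pairing {G : Type} [Fintype G] (Γ : G × G → ℝ) (f : G → ℝ) : ℝ :=
  ∑ p : G × G, Γ p * f p.2

/-- The linear-program value `φ(f) = max_{Γ ∈ B} ⟨Γ, f⟩`. -/
noncomputable def lpValue {G : Type} [Fintype G] (B : Set (G × G → ℝ)) (f : G → ℝ) : ℝ :=
  sSup ((fun Γ => pairing Γ f) '' B)

/-- The argmax set `S*(f) = {Γ ∈ B : ⟨Γ, f⟩ = φ(f)}`. -/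
def argmaxSet {G : Type} [Fintype G] (B : Set (G × G → ℝ)) (f : G → ℝ) :
    Set (G × G → ℝ) :=
  {Γ ∈ B | pairing Γ f = lpValue B f}

lemma continuous_pairing {G : Type} [Fintype G] :
    Continuous fun x : (G × G → ℝ) × (G → ℝ) => pairing x.1 x.2 := by
  unfold pairing
  fun_prop

lemma Filter.Tendsto.pairing {G ι : Type} [Fintype G] {l : Filter ι}
    {Γ : ι → G × G → ℝ} {f : ι → G → ℝ} {Γ' : G × G → ℝ} {f' : G → ℝ}
    (hΓ : Tendsto Γ l (𝓝 Γ')) (hf : Tendsto f l (𝓝 f')) :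
    Tendsto (fun i => pairing (Γ i) (f i)) l (𝓝 (pairing Γ' f')) :=
  (continuous_pairing.tendsto (Γ', f')).comp (hΓ.prodMk_nhds hf)

lemma continuous_pairing_left {G : Type} [Fintype G] (f : G → ℝ) :
    Continuous fun Γ : G × G → ℝ => pairing Γ f :=
  continuous_pairing.comp (continuous_id.prodMk continuous_const)

lemma pairing_add_mul {G : Type} [Fintype G] (Γ : G × G → ℝ) (f k : G → ℝ) (t : ℝ) :
    pairing Γ (fun v => f v + t * k v) = pairing Γ f + t * pairing Γ k := by
  simp only [pairing, Finset.mul_sum, ← Finset.sum_add_distrib]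
  exact Finset.sum_congr rfl fun p _ => by ring

lemma pairing_le_of_mem_argmaxSet {G : Type} [Fintype G] {B : Set (G × G → ℝ)}
    (hB : IsCompact B) {f : G → ℝ} {Γ Γ' : G × G → ℝ} (hΓ : Γ ∈ B)
    (hΓ' : Γ' ∈ argmaxSet B f) : pairing Γ f ≤ pairing Γ' f := by
  rw [hΓ'.2]
  exact le_csSup (hB.image (continuous_pairing_left f)).bddAbove (Set.mem_image_of_mem _ hΓ)

lemma isCompact_argmaxSet {G : Type} [Fintype G] {B : Set (G × G → ℝ)}
    (hB : IsCompact B) (f : G → ℝ) : IsCompact (argmaxSet B f) :=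
  hB.inter_right (isClosed_eq (continuous_pairing_left f) continuous_const)

/-- Limits of maximizers of perturbed programs maximize the limiting program. -/
lemma mem_argmaxSet_of_tendsto {G ι : Type} [Fintype G] {B : Set (G × G → ℝ)}
    (hB : IsCompact B) {l : Filter ι} [l.NeBot] {Γ : ι → G × G → ℝ} {g : ι → G → ℝ}
    {Γ' Γ₀ : G × G → ℝ} {f : G → ℝ} (hΓ : Tendsto Γ l (𝓝 Γ')) (hg : Tendsto g l (𝓝 f))
    (hmax : ∀ᶠ i in l, Γ i ∈ argmaxSet B (g i)) (hΓ₀ : Γ₀ ∈ argmaxSet B f) :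
    Γ' ∈ argmaxSet B f := by
  have hmem : Γ' ∈ B := hB.isClosed.mem_of_tendsto hΓ (hmax.mono fun _ hi => hi.1)
  refine ⟨hmem, le_antisymm ?_ ?_⟩
  · rw [← hΓ₀.2]
    exact pairing_le_of_mem_argmaxSet hB hmem hΓ₀
  · rw [← hΓ₀.2]
    exact le_of_tendsto_of_tendsto (tendsto_const_nhds.pairing hg) (hΓ.pairing hg)
      (hmax.mono fun _ hi => pairing_le_of_mem_argmaxSet hB hΓ₀.1 hi)

/-- **Upper half of the directional-derivative bound.**
For every `f, h : 𝒢 → ℝ`, every family `(h_t)_{t>0}` with `h_t → h` as `t ↓ 0`, and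
every selection `Γ_t ∈ S*(f + t h_t)` (for `t > 0`) and `Γ_0 ∈ S*(f)`:
`limsup_{t↓0} (⟨Γ_t, f + t h_t⟩ − ⟨Γ_0, f⟩)/t ≤ max_{Γ ∈ S*(f)} ⟨Γ, h⟩`. -/
theorem stmt_3
    (G : Type) [Fintype G] [Nonempty G]
    (B : Set (G × G → ℝ)) (hBne : B.Nonempty) (hBcomp : IsCompact B)
    (f h : G → ℝ) (ht : ℝ → G → ℝ)
    (hconv : Tendsto ht (𝓝[>] (0 : ℝ)) (𝓝 h))
    (Γt : ℝ → G × G → ℝ)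
    (hΓt : ∀ t : ℝ, 0 < t → Γt t ∈ argmaxSet B (fun v => f v + t * ht t v))
    (Γ0 : G × G → ℝ) (hΓ0 : Γ0 ∈ argmaxSet B f) :
    ∃ M : ℝ,
      IsGreatest ((fun Γ => pairing Γ h) '' argmaxSet B f) M ∧
      Filter.limsup
        (fun t : ℝ => (pairing (Γt t) (fun v => f v + t * ht t v) - pairing Γ0 f) / t)
        (𝓝[>] (0 : ℝ)) ≤ M := by
  obtain ⟨M, hM⟩ := ((isCompact_argmaxSet hBcomp f).image
    (continuous_pairing_left h)).exists_isGreatest (Set.Nonempty.image _ ⟨Γ0, hΓ0⟩)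
  refine ⟨M, hM, ?_⟩
  have hpos : ∀ᶠ t : ℝ in 𝓝[>] (0 : ℝ), 0 < t := eventually_mem_nhdsWithin
  have htendsto : Tendsto (fun t v => f v + t * ht t v) (𝓝[>] (0 : ℝ)) (𝓝 f) := by
    rw [tendsto_pi_nhds]
    intro v
    have ht0 : Tendsto (fun t : ℝ => t) (𝓝[>] (0 : ℝ)) (𝓝 0) :=
      tendsto_id.mono_left nhdsWithin_le_nhds
    simpa using (tendsto_const_nhds (x := f v)).add (ht0.mul (tendsto_pi_nhds.1 hconv v))
  have hlower : ∀ᶠ t in 𝓝[>] (0 : ℝ), pairing Γ0 h - 1 ≤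
      (pairing (Γt t) (fun v => f v + t * ht t v) - pairing Γ0 f) / t := by
    have hlim := (tendsto_const_nhds (x := Γ0)).pairing hconv
    filter_upwards [hpos, hlim.eventually (lt_mem_nhds (sub_one_lt _))] with t h0 hlt
    have hle := pairing_le_of_mem_argmaxSet hBcomp hΓ0.1 (hΓt t h0)
    rw [pairing_add_mul Γ0] at hle
    rw [le_div_iff₀ h0]
    nlinarith
  have hupper : ∀ t : ℝ, 0 < t →
      (pairing (Γt t) (fun v => f v + t * ht t v) - pairing Γ0 f) / t ≤
        pairing (Γt t) (ht t) := by
    intro t h0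
    have hle := pairing_le_of_mem_argmaxSet hBcomp (hΓt t h0).1 hΓ0
    rw [pairing_add_mul, div_le_iff₀ h0]
    linarith
  refine le_of_forall_pos_le_add fun ε hε => limsup_le_of_le
    (IsBoundedUnder.isCoboundedUnder_le ⟨_, eventually_map.2 hlower⟩) ?_
  suffices hev : ∀ᶠ t in 𝓝[>] (0 : ℝ), pairing (Γt t) (ht t) ≤ M + ε by
    filter_upwards [hpos, hev] with t h0 hle
    exact (hupper t h0).trans hle
  by_contra hcon
  have := frequently_iff_neBot.1 (not_eventually.1 hcon)
  obtain ⟨U, hU'⟩ := Ultrafilter.exists_le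
    (𝓝[>] (0 : ℝ) ⊓ 𝓟 {t | ¬ pairing (Γt t) (ht t) ≤ M + ε})
  obtain ⟨hU, hbig⟩ := le_inf_iff.1 hU'
  rw [le_principal_iff] at hbig
  have hmax : ∀ᶠ t in (U : Filter ℝ), Γt t ∈ argmaxSet B (fun v => f v + t * ht t v) :=
    (hpos.filter_mono hU).mono hΓt
  obtain ⟨Γ', -, hlim⟩ := hBcomp.ultrafilter_le_nhds (U.map Γt)
    (le_principal_iff.2 (hmax.mono fun _ hi => hi.1))
  have hmem : Γ' ∈ argmaxSet B f :=
    mem_argmaxSet_of_tendsto hBcomp hlim (htendsto.mono_left hU) hmax hΓ0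
  have hge : M + ε ≤ pairing Γ' h :=
    ge_of_tendsto (Filter.Tendsto.pairing hlim (hconv.mono_left hU))
      (Filter.mem_of_superset hbig fun _ hi => (not_le.1 hi).le)
  have hle : pairing Γ' h ≤ M := hM.2 (Set.mem_image_of_mem _ hmem)
  linarith
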